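/- arXiv:2404.09266 — 3 statements merged into one kernel-verified Lean document; each statement's English description precedes it below -/
import Mathlib

section
/- In the grevlex enumeration of the multi-indices of total degree at most n, every monomial after the first is a coordinate variable times an earlier monomial: if α_1 ≺ α_2 ≺ … ≺ α_g is the enumeration of {α ∈ ℕ^d : |α| ≤ n} in increasing grevlex order (g = C(n+d, d)), then for every i with 2 ≤ i ≤ g there exist an index s with 1 ≤ s ≤ i−1 and a coordinate u ∈ {1,…,d} such that α_i = α_s + e_u. -/
/-- The grevlex relation on multi-indices `α, β : Fin d → ℕ`. -/
def Grevlex (d : ℕ) (α β : Fin d → ℕ) : Prop :=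
  (∑ j, α j < ∑ j, β j) ∨
    ((∑ j, α j = ∑ j, β j) ∧
      ∃ k : Fin d, (∀ j : Fin d, j < k → α j = β j) ∧ β k < α k)

theorem Grevlex.sum_le {d : ℕ} {α β : Fin d → ℕ} (h : Grevlex d α β) :
    ∑ j, α j ≤ ∑ j, β j :=
  h.elim le_of_lt fun h => h.1.le

theorem Grevlex.exists_pos {d : ℕ} {α β : Fin d → ℕ} (h : Grevlex d α β) :
    ∃ u, 0 < β u := by
  have hpos : 0 < ∑ j, β j := by
    rcases h with h | ⟨h, k, -, hk⟩
    · exact Nat.zero_lt_of_lt h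
    · rw [← h]
      exact (Nat.zero_lt_of_lt hk).trans_le
        (Finset.single_le_sum (fun _ _ => Nat.zero_le _) (Finset.mem_univ k))
  obtain ⟨u, -, hu⟩ := Finset.sum_pos_iff.mp hpos
  exact ⟨u, hu⟩

/-- In the grevlex enumeration `A 0 ≺ A 1 ≺ … ≺ A (g-1)` of the multi-indices of total
degree at most `n` (with `g = C(n+d,d)`), every monomial after the first is a coordinate
variable times an earlier monomial: for every index `i` with `1 ≤ i < g` (`0`-based, i.e.
`2 ≤ i ≤ g` in `1`-based counting) there exist `s < i` and `u` with `A i = A s + e_u`. -/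
theorem grevlex_enum_generating (d n g : ℕ) (hd : 1 ≤ d) (hn : 1 ≤ n)
    (hg : g = (n + d).choose d)
    (A : ℕ → Fin d → ℕ)
    (hmono : ∀ i j : ℕ, i < j → j < g → Grevlex d (A i) (A j))
    (hrange : ∀ α : Fin d → ℕ, (∑ j, α j ≤ n) ↔ ∃ i < g, A i = α)
    (i : ℕ) (hi1 : 1 ≤ i) (hig : i < g) :
    ∃ s < i, ∃ u : Fin d, A i = A s + Pi.single u 1 := by
  obtain ⟨u, hu⟩ := (hmono 0 i hi1 hig).exists_pos
  have hadd : A i = (A i - Pi.single u 1) + Pi.single u 1 :=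
    (tsub_add_cancel_of_le (by
      intro j
      rcases eq_or_ne j u with rfl | hj
      · simpa using Nat.succ_le_of_lt hu
      · simp [hj])).symm
  have hsum : ∑ j, A i j = ∑ j, (A i - Pi.single u 1 : Fin d → ℕ) j + 1 := by
    conv_lhs => rw [hadd]
    simp only [Pi.add_apply, Finset.sum_add_distrib, Fintype.sum_pi_single']
  have hi : ∑ j, A i j ≤ n := (hrange (A i)).mpr ⟨i, hig, rfl⟩
  obtain ⟨s, hsg, hs⟩ := (hrange (A i - Pi.single u 1)).mp (by omega)
  rw [← hs] at hadd hsum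
  refine ⟨s, ?_, u, hadd⟩
  by_contra! his
  rcases his.eq_or_lt with rfl | his
  · omega
  · have := (hmono i s his hsg).sum_le
    omega
end

section
/- (Lemma 2.1) Let α_1 ≺ α_2 ≺ … ≺ α_g be the enumeration of {α ∈ ℕ^d : |α| ≤ n} in increasing grevlex order (g = C(n+d, d)) and let φ_i = x^{α_i} be the corresponding monomials in the polynomial ring ℂ[x_1,…,x_d]. Fix i with 2 ≤ i ≤ g, let s_i be the smallest index s < i such that there exists u ∈ {1,…,d} with α_i = α_s + e_u, and let u_i ∈ {1,…,d} be any coordinate with α_i = α_{s_i} + e_{u_i}. Then for every j with 1 ≤ j ≤ s_i − 1, the polynomial x_{u_i}·φ_j lies in the ℂ-linear span of {φ_1, …, φ_{i−1}}; equivalently, there exists ℓ ≤ i−1 with α_j + e_{u_i} = α_ℓ. -/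
/-- The monomial `x^α ∈ ℂ[x_1,…,x_d]` attached to a multi-index `α : Fin d → ℕ`. -/
noncomputable def monom {d : ℕ} (α : Fin d → ℕ) : MvPolynomial (Fin d) ℂ :=
  MvPolynomial.monomial (Finsupp.equivFunOnFinite.symm α) (1 : ℂ)

theorem Grevlex.asymm {d : ℕ} {α β : Fin d → ℕ} (h : Grevlex d α β) : ¬ Grevlex d β α := by
  rintro (h' | ⟨h', k', hk', hlt'⟩)
  · rcases h with h | ⟨h, -⟩ <;> omega
  rcases h with h | ⟨-, k, hk, hlt⟩
  · omega
  rcases lt_trichotomy k k' with hkk | rfl | hkk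
  · exact hlt.ne (hk' k hkk)
  · exact lt_asymm hlt hlt'
  · exact hlt'.ne (hk k' hkk)

theorem Grevlex.add_right {d : ℕ} {α β : Fin d → ℕ} (h : Grevlex d α β) (γ : Fin d → ℕ) :
    Grevlex d (α + γ) (β + γ) := by
  simpa [Grevlex, Finset.sum_add_distrib] using h

theorem X_mul_monom {d : ℕ} (u : Fin d) (α : Fin d → ℕ) :
    MvPolynomial.X u * monom α = monom (α + Pi.single u 1) := by
  rw [monom, monom, MvPolynomial.X, MvPolynomial.monomial_mul, one_mul, add_comm]
  refine congrArg (MvPolynomial.monomial · (1 : ℂ)) (Finsupp.ext fun j => ?_)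
  simp [Finsupp.single_apply, Pi.single_apply, eq_comm]

/-- Lemma 2.1: with `A` the grevlex enumeration of `{α : |α| ≤ n}` (`g = C(n+d,d)`),
`φ_i = x^{A i}`, `s` the smallest index `< i` such that `A i = A s + e_u` for some `u`,
and `u` such a coordinate, then for every `j < s` the polynomial `x_u · φ_j` lies in
the span of `φ_0, …, φ_{i-1}`; equivalently `A j + e_u = A l` for some `l < i`. -/
theorem lemma_2_1 (d n g : ℕ) (hd : 1 ≤ d) (hn : 1 ≤ n)
    (hg : g = (n + d).choose d)
    (A : ℕ → Fin d → ℕ)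
    (hmono : ∀ i j : ℕ, i < j → j < g → Grevlex d (A i) (A j))
    (hrange : ∀ α : Fin d → ℕ, (∑ j, α j ≤ n) ↔ ∃ i < g, A i = α)
    (i : ℕ) (hi1 : 1 ≤ i) (hig : i < g)
    (s : ℕ) (u : Fin d)
    (hs : s < i) (hu : A i = A s + Pi.single u 1)
    (hmin : ∀ s' < i, (∃ u' : Fin d, A i = A s' + Pi.single u' 1) → s ≤ s')
    (j : ℕ) (hj : j < s) :
    (MvPolynomial.X u * monom (A j)) ∈
      Submodule.span ℂ {p : MvPolynomial (Fin d) ℂ | ∃ l < i, p = monom (A l)} ∧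
    ∃ l < i, A j + Pi.single u 1 = A l := by
  have hlt : Grevlex d (A j + Pi.single u 1) (A i) := by
    rw [hu]
    exact (hmono j s hj (hs.trans hig)).add_right _
  obtain ⟨l, hlg, hl⟩ := (hrange (A j + Pi.single u 1)).1
    (hlt.sum_le.trans ((hrange (A i)).2 ⟨i, hig, rfl⟩))
  rw [← hl] at hlt
  have hli : l < i := by
    by_contra! hil
    rcases hil.eq_or_lt with rfl | hil
    · exact hlt.asymm hlt
    · exact hlt.asymm (hmono i l hil hlg)
  refine ⟨Submodule.subset_span ⟨l, hli, ?_⟩, l, hli, hl.symm⟩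
  rw [X_mul_monom, hl]
end

section
/- Structural property of confluent Vandermonde columns: let α_1 ≺ α_2 ≺ … ≺ α_g be the grevlex enumeration of {α ∈ ℕ^d : |α| ≤ n}, φ_i = x^{α_i}, and v_i = v(φ_i) the confluent Vandermonde columns at nodes x_1, …, x_m ∈ ℂ^d. Fix i with 2 ≤ i ≤ g, let s_i be the smallest index s < i such that there exists u with α_i = α_s + e_u, and let u_i be any such coordinate for s_i. Then for every j with 1 ≤ j ≤ s_i − 1, the vector 𝐗_{u_i}^{(2)} v_j lies in the ℂ-linear span of {v_1, …, v_{i−1}}. -/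
/-- Block labels for the confluent Vandermonde column (with derivatives up to order 2). -/
abbrev Idx (d : ℕ) := Unit ⊕ Fin d ⊕ {p : Fin d × Fin d // p.1 ≤ p.2}

/-- The confluent Vandermonde column `v(p) ∈ ℂ^{m d̃}` of a polynomial `p` at the
nodes `x 0, …, x (m-1) ∈ ℂ^d`. -/
noncomputable def vcol {d m : ℕ} (x : Fin m → Fin d → ℂ)
    (p : MvPolynomial (Fin d) ℂ) : Idx d × Fin m → ℂ
  | (Sum.inl _, j) => MvPolynomial.eval (x j) p
  | (Sum.inr (Sum.inl k), j) => MvPolynomial.eval (x j) (MvPolynomial.pderiv k p)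
  | (Sum.inr (Sum.inr ki), j) =>
      MvPolynomial.eval (x j) (MvPolynomial.pderiv ki.1.1 (MvPolynomial.pderiv ki.1.2 p))

/-- The off-diagonal block coefficients of `𝐗_u^{(2)}`. -/
def offCoeff {d : ℕ} (u : Fin d) : Idx d → Idx d → ℂ
  | Sum.inr (Sum.inl j), Sum.inl _ => if u = j then 1 else 0
  | Sum.inr (Sum.inr ki), Sum.inr (Sum.inl j) =>
      (if u = ki.1.1 ∧ ki.1.2 = j then 1 else 0) +
      (if u = ki.1.2 ∧ ki.1.1 = j then 1 else 0)
  | _, _ => 0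

/-- The matrix `𝐗_u^{(2)} ∈ ℂ^{m d̃ × m d̃}`. -/
noncomputable def XMat {d m : ℕ} (x : Fin m → Fin d → ℂ) (u : Fin d) :
    Matrix (Idx d × Fin m) (Idx d × Fin m) ℂ :=
  Matrix.of fun p q =>
    (if p.1 = q.1 ∧ p.2 = q.2 then x p.2 u else 0) +
    (if p.2 = q.2 then offCoeff u p.1 q.1 else 0)

theorem monom_add_single {d : ℕ} (α : Fin d → ℕ) (u : Fin d) :
    monom (α + Pi.single u 1) = MvPolynomial.X u * monom α := by
  have h : Finsupp.equivFunOnFinite.symm (α + Pi.single u 1) =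
      Finsupp.single u 1 + Finsupp.equivFunOnFinite.symm α := by
    ext k
    simp [Finsupp.single_apply, Pi.single_apply, add_comm, eq_comm]
  rw [monom, monom, MvPolynomial.X, MvPolynomial.monomial_mul, one_mul, h]

theorem XMat_mulVec_apply {d m : ℕ} (x : Fin m → Fin d → ℂ) (u : Fin d)
    (w : Idx d × Fin m → ℂ) (a : Idx d) (j : Fin m) :
    (XMat x u).mulVec w (a, j) = x j u * w (a, j) + ∑ b, offCoeff u a b * w (b, j) := by
  simp [XMat, Matrix.mulVec, dotProduct, Fintype.sum_prod_type, add_mul, ite_and,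
    Finset.sum_add_distrib, -Fintype.sum_sum_type]

/-- The matrix `𝐗_u^{(2)}` acts on confluent Vandermonde columns as multiplication by `x_u`. -/
theorem XMat_mulVec_vcol {d m : ℕ} (x : Fin m → Fin d → ℂ) (u : Fin d)
    (p : MvPolynomial (Fin d) ℂ) :
    (XMat x u).mulVec (vcol x p) = vcol x (MvPolynomial.X u * p) := by
  funext ⟨a, j⟩
  rw [XMat_mulVec_apply]
  rcases a with a | k | ⟨⟨k, l⟩, hkl⟩
  · simp [vcol, offCoeff]
  · rcases eq_or_ne u k with rfl | h <;>
      simp [vcol, offCoeff, MvPolynomial.pderiv_X, *]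
  · rcases eq_or_ne u k with rfl | h <;> rcases eq_or_ne u l with rfl | h' <;>
      simp [vcol, offCoeff, MvPolynomial.pderiv_X, add_mul, ite_and, Finset.sum_add_distrib, *,
        Ne.symm, add_assoc]

/-- Structural property of confluent Vandermonde columns: with `A` the grevlex
enumeration of `{α : |α| ≤ n}`, `v_l = v(x^{A l})`, `s` the smallest index `< i` with
`A i = A s + e_u` for some `u`, and `u` such a coordinate for `s`, for every `j < s`
the vector `𝐗_u^{(2)} v_j` lies in the span of `v_0, …, v_{i-1}`. -/
theorem XMat_vcol_mem_span {d n m g : ℕ}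
    (A : ℕ → Fin d → ℕ)
    (hmono : ∀ i j : ℕ, i < j → j < g → Grevlex d (A i) (A j))
    (hrange : ∀ α : Fin d → ℕ, (∑ j, α j ≤ n) ↔ ∃ i < g, A i = α)
    (x : Fin m → Fin d → ℂ)
    (i : ℕ) (hi1 : 1 ≤ i) (hig : i < g)
    (s : ℕ) (u : Fin d)
    (hs : s < i) (hu : A i = A s + Pi.single u 1)
    (hmin : ∀ s' < i, (∃ u' : Fin d, A i = A s' + Pi.single u' 1) → s ≤ s')
    (j : ℕ) (hj : j < s) :
    (XMat x u).mulVec (vcol x (monom (A j))) ∈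
      Submodule.span ℂ {y : Idx d × Fin m → ℂ | ∃ l < i, y = vcol x (monom (A l))} := by
  rw [XMat_mulVec_vcol, ← monom_add_single]
  have hlt : Grevlex d (A j + Pi.single u 1) (A i) :=
    hu ▸ (hmono j s hj (hs.trans hig)).add_right _
  obtain ⟨l, hl, hAl⟩ :=
    (hrange _).1 (hlt.sum_le.trans ((hrange (A i)).2 ⟨i, hig, rfl⟩))
  rw [← hAl] at hlt ⊢
  refine Submodule.subset_span ⟨l, ?_, rfl⟩
  by_contra! hil
  rcases hil.eq_or_lt with rfl | hil
  · exact hlt.asymm hlt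
  · exact hlt.asymm (hmono i l hil hl)
end
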